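/- Let ι : R ↪ T be an embedding of integral domains with the same quotient field, and let ∗ be a semistar operation on R. Define E^{∗_ι} := E^∗ for each nonzero T-submodule E of the quotient field. Then ∗_ι is a semistar operation on T, and if ∗ is of finite type on R then ∗_ι is of finite type on T. -/

import Mathlib

open Pointwise

/-- A semistar operation on a domain `A` with (quotient) field `K`, acting on the
nonzero `A`-submodules of `K` (the value on `⊥` is irrelevant). -/
structure SemistarOp (A K : Type*) [CommRing A] [Field K] [Algebra A K] where
  toFun : Submodule A K → Submodule A K
  star_smul : ∀ (x : K) (E : Submodule A K), x ≠ 0 → E ≠ ⊥ → toFun (x • E) = x • toFun E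
  mono : ∀ E F : Submodule A K, E ≠ ⊥ → F ≠ ⊥ → E ≤ F → toFun E ≤ toFun F
  le_star : ∀ E : Submodule A K, E ≠ ⊥ → E ≤ toFun E
  star_idem : ∀ E : Submodule A K, E ≠ ⊥ → toFun (toFun E) = toFun E

/-- A semistar operation is of finite type if `E^⋆` is the union of `F^⋆` over the
nonzero finitely generated submodules `F ⊆ E`. -/
def SemistarOp.FiniteType {A K : Type*} [CommRing A] [Field K] [Algebra A K]
    (s : SemistarOp A K) : Prop :=
  ∀ E : Submodule A K, E ≠ ⊥ →
    s.toFun E = ⨆ F : {F : Submodule A K // F ≠ ⊥ ∧ F.FG ∧ F ≤ E}, s.toFun F.1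

theorem restrict_ne_bot_aux {R K : Type*} [CommRing R] [Field K] [Algebra R K]
    (T : Subalgebra R K) {E : Submodule T K} (hE : E ≠ ⊥) : E.restrictScalars R ≠ ⊥ := by
  intro h
  exact hE ((Submodule.restrictScalars_eq_bot_iff R T K).1 h)

theorem star_closed_aux {R K : Type*} [CommRing R] [Field K] [Algebra R K]
    (T : Subalgebra R K) (s : SemistarOp R K) (E : Submodule T K) (hE : E ≠ ⊥)
    (t : T) {x : K} (hx : x ∈ s.toFun (E.restrictScalars R)) :
    t • x ∈ s.toFun (E.restrictScalars R) := by
  have hE' := restrict_ne_bot_aux T hE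
  by_cases ht : (t : K) = 0
  · have : t • x = 0 := by rw [Algebra.smul_def]; simp [ht]
    rw [this]; exact zero_mem _
  have hne : (t : K) • E.restrictScalars R ≠ ⊥ := by
    obtain ⟨y, hy, hy0⟩ := Submodule.exists_mem_ne_zero_of_ne_bot hE'
    intro h
    have h1 : (t : K) • y ∈ (t : K) • E.restrictScalars R :=
      Submodule.smul_mem_pointwise_smul y _ _ hy
    rw [h, Submodule.mem_bot] at h1
    exact (mul_ne_zero ht hy0) h1
  have hle : (t : K) • E.restrictScalars R ≤ E.restrictScalars R := by
    intro z hz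
    obtain ⟨y, hy, rfl⟩ := (Submodule.mem_smul_pointwise_iff_exists _ _ _).1 hz
    exact E.smul_mem t hy
  apply s.mono _ _ hne hE' hle
  rw [s.star_smul _ _ ht hE']
  exact Submodule.smul_mem_pointwise_smul x (t : K) _ hx

open Classical in
/-- The restricted operation on `T`-submodules. -/
noncomputable def restrictStarAux {R K : Type*} [CommRing R] [Field K] [Algebra R K]
    (T : Subalgebra R K) (s : SemistarOp R K) (E : Submodule T K) : Submodule T K :=
  if hE : E = ⊥ then ⊥ else
    { (s.toFun (E.restrictScalars R)).toAddSubmonoid with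
      smul_mem' := fun t _ hx => star_closed_aux T s E hE t hx }

theorem restrictStarAux_spec {R K : Type*} [CommRing R] [Field K] [Algebra R K]
    (T : Subalgebra R K) (s : SemistarOp R K) (E : Submodule T K) (hE : E ≠ ⊥) :
    (restrictStarAux T s E).restrictScalars R = s.toFun (E.restrictScalars R) := by
  unfold restrictStarAux
  rw [dif_neg hE]
  rfl

theorem restrict_smul_aux {R K : Type*} [CommRing R] [Field K] [Algebra R K]
    (T : Subalgebra R K) (x : K) (E : Submodule T K) :
    (x • E).restrictScalars R = x • E.restrictScalars R := by
  ext z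
  simp [Submodule.mem_smul_pointwise_iff_exists]

/-- Let `R ⊆ T` have the same quotient field `K` and `∗` a semistar operation on `R`.
Then `E ↦ E^∗` (on nonzero `T`-submodules of `K`) defines a semistar operation `∗_ι` on
`T`, which is of finite type whenever `∗` is. -/
theorem semistar_restrict_to_overring
    {R K : Type*} [CommRing R] [Field K] [Algebra R K]
    (T : Subalgebra R K) (s : SemistarOp R K) :
    ∃ sT : SemistarOp ↥T K,
      (∀ E : Submodule ↥T K, E ≠ ⊥ →
        (sT.toFun E).restrictScalars R = s.toFun (E.restrictScalars R)) ∧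
      (s.FiniteType → sT.FiniteType) := by
  have inj := Submodule.restrictScalars_injective R T K
  have spec := restrictStarAux_spec T s
  have lestar : ∀ E : Submodule T K, E ≠ ⊥ → E ≤ restrictStarAux T s E := by
    intro E hE
    have h := s.le_star _ (restrict_ne_bot_aux T hE)
    rw [← spec E hE] at h
    exact h
  have mono : ∀ E F : Submodule T K, E ≠ ⊥ → F ≠ ⊥ → E ≤ F →
      restrictStarAux T s E ≤ restrictStarAux T s F := by
    intro E F hE hF hEF
    have h := s.mono _ _ (restrict_ne_bot_aux T hE) (restrict_ne_bot_aux T hF) (show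
      E.restrictScalars R ≤ F.restrictScalars R from hEF)
    rw [← spec E hE, ← spec F hF] at h
    exact h
  refine ⟨⟨restrictStarAux T s, ?_, mono, lestar, ?_⟩, spec, ?_⟩
  · intro x E hx hE
    have hne : x • E ≠ ⊥ := by
      obtain ⟨y, hy, hy0⟩ := Submodule.exists_mem_ne_zero_of_ne_bot hE
      intro h
      have h1 : x • y ∈ x • E := Submodule.smul_mem_pointwise_smul y _ _ hy
      rw [h, Submodule.mem_bot] at h1
      exact (mul_ne_zero hx hy0) h1
    apply inj
    rw [spec _ hne, restrict_smul_aux, restrict_smul_aux, spec E hE,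
      s.star_smul _ _ hx (restrict_ne_bot_aux T hE)]
  · intro E hE
    have hne : restrictStarAux T s E ≠ ⊥ := ne_bot_of_le_ne_bot hE (lestar E hE)
    apply inj
    rw [spec _ hne, spec E hE, s.star_idem _ (restrict_ne_bot_aux T hE)]
  · intro hs E hE
    apply le_antisymm
    · change (restrictStarAux T s E).restrictScalars R ≤ Submodule.restrictScalars R
        (⨆ F : {F : Submodule T K // F ≠ ⊥ ∧ F.FG ∧ F ≤ E}, restrictStarAux T s F.1)
      rw [spec E hE, hs _ (restrict_ne_bot_aux T hE)]
      apply iSup_le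
      rintro ⟨F, hF0, hFG, hFE⟩
      have hsub : F ≤ (Submodule.span T (F : Set K)).restrictScalars R :=
        fun z hz => Submodule.subset_span hz
      have hG0 : Submodule.span T (F : Set K) ≠ ⊥ := by
        intro h
        rw [h] at hsub
        exact hF0 (le_bot_iff.1 hsub)
      have hGE : Submodule.span T (F : Set K) ≤ E := Submodule.span_le.2 hFE
      have hGfg : (Submodule.span T (F : Set K)).FG := by
        obtain ⟨S, rfl⟩ := hFG
        exact ⟨S, by rw [Submodule.span_span_of_tower]⟩
      have h1 := s.mono _ _ hF0 (restrict_ne_bot_aux T hG0) hsub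
      rw [← spec _ hG0] at h1
      refine h1.trans ?_
      have h2 := le_iSup (fun F : {F : Submodule T K // F ≠ ⊥ ∧ F.FG ∧ F ≤ E} =>
        restrictStarAux T s F.1) ⟨_, hG0, hGfg, hGE⟩
      exact h2
    · apply iSup_le
      rintro ⟨F, hF0, hFG, hFE⟩
      exact mono F E hF0 hE hFE
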